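/- arXiv:2504.18292 — 6 statements merged into one kernel-verified Lean document; each statement's English description precedes it below -/
import Mathlib

section
/- Let u, v, L > 0 and let Ψ(w) = Γ(u+w)Γ(u−w)Γ(v+w)Γ(v−w)e^{Lw²}/(Γ(2w)Γ(−2w)). Let Z = ∫_ℝ Ψ(ix) dx/(2π), which is a finite positive real number, and for σ ∈ ℝ and a function F write ∫_{σ+iℝ} ν(dw) F(w) := (1/Z)∫_ℝ Ψ(σ+it) F(σ+it) dt/(2π). Fix δ ∈ (0, min(u,v,1)) and n ∈ ℂ. Suppose f and h are continuous on the closed strip S = {w ∈ ℂ : 0 ≤ Re w ≤ 1}, holomorphic in its interior, and polynomially bounded on S, and that h(−w) = h(w) for all w ∈ iℝ. If for all w₁ ∈ S one has f(w₁) = 2n ∫_{δ+iℝ} ν(dw₂) f(w₁)f(w₂)/(w₁+w₂) + h(w₁), then for every ξ ∈ ℂ, ∫_{iℝ} ν(dw) f(w)(e^{ξw} − e^{−ξw}) = 2n ∫_{iℝ} ν(dw₁) ∫_{iℝ} ν(dw₂) f(w₁)f(w₂)(e^{ξw₂} − e^{−ξw₁})/(w₁+w₂), where the integrand of the double integral is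 extended by continuity across the removable singularity at w₁ + w₂ = 0. -/
open Complex MeasureTheory
open scoped Classical

/-- The weight function
`Ψ(w) = Γ(u+w)Γ(u−w)Γ(v+w)Γ(v−w)e^{Lw²}/(Γ(2w)Γ(−2w))`. -/
noncomputable def Psi (u v L : ℝ) (w : ℂ) : ℂ :=
  Complex.Gamma (u + w) * Complex.Gamma (u - w) * Complex.Gamma (v + w) *
    Complex.Gamma (v - w) * Complex.exp (L * w ^ 2) /
    (Complex.Gamma (2 * w) * Complex.Gamma (-(2 * w)))

/-- The closed strip `S = {w : 0 ≤ Re w ≤ 1}`. -/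
def strip : Set ℂ := {w : ℂ | 0 ≤ w.re ∧ w.re ≤ 1}

/-- The integrand `f(w₁)f(w₂)(e^{ξw₂} − e^{−ξw₁})/(w₁+w₂)`, extended by continuity
across the removable singularity at `w₁ + w₂ = 0` (where its value is
`f(w₁)f(w₂)·ξe^{ξw₂}`). -/
noncomputable def extIntegrand (f : ℂ → ℂ) (ξ w₁ w₂ : ℂ) : ℂ :=
  if w₁ + w₂ = 0 then f w₁ * f w₂ * (ξ * Complex.exp (ξ * w₂))
  else f w₁ * f w₂ * ((Complex.exp (ξ * w₂) - Complex.exp (-(ξ * w₁))) / (w₁ + w₂))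

/-- Decay along vertical lines of a closed strip, faster than every exponential. -/
def SuperExpDecay (δ : ℝ) (P : ℂ → ℂ) : Prop :=
  ∀ a : ℝ, ∃ K : ℝ, ∀ w : ℂ, 0 ≤ w.re → w.re ≤ δ → ‖P w‖ ≤ K * Real.exp (-(a * |w.im|))

lemma integrable_of_le_exp_neg_abs {p : ℝ → ℂ} (hp : Continuous p) {K : ℝ}
    (hK : ∀ t, ‖p t‖ ≤ K * Real.exp (-|t|)) : Integrable p := by
  have hK0 : 0 ≤ K := by
    have h := (norm_nonneg _).trans (hK 0)
    simpa using h
  refine Integrable.mono' (integrable_inv_one_add_sq.const_mul (2 * K))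
    hp.aestronglyMeasurable (Filter.Eventually.of_forall fun t => (hK t).trans ?_)
  have h1 := Real.quadratic_le_exp_of_nonneg (abs_nonneg t)
  have h2 : Real.exp (-|t|) ≤ 2 * (1 + t ^ 2)⁻¹ := by
    rw [Real.exp_neg, inv_le_comm₀ (Real.exp_pos _) (by positivity), mul_inv, inv_inv]
    nlinarith [abs_nonneg t, sq_abs t]
  calc K * Real.exp (-|t|) ≤ K * (2 * (1 + t ^ 2)⁻¹) := by gcongr
    _ = 2 * K * (1 + t ^ 2)⁻¹ := by ring

/-- Shifting a vertical contour across a strip, from its left edge to its right edge. -/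
lemma integral_vertical_shift {δ : ℝ} (hδ : 0 < δ) {F : ℂ → ℂ}
    (hc : ContinuousOn F {w : ℂ | 0 ≤ w.re ∧ w.re ≤ δ})
    (hd : DifferentiableOn ℂ F {w : ℂ | 0 < w.re ∧ w.re < δ}) {K : ℝ}
    (hK : ∀ w : ℂ, 0 ≤ w.re → w.re ≤ δ → ‖F w‖ ≤ K * Real.exp (-|w.im|)) :
    ∫ t : ℝ, F (I * t) = ∫ t : ℝ, F (δ + I * t) := by
  have i0 : Integrable fun t : ℝ => F (I * t) := by
    refine integrable_of_le_exp_neg_abs (K := K)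
      (hc.comp_continuous (by fun_prop) fun t => by simp [hδ.le]) fun t => ?_
    simpa using hK (I * t) (by simp) (by simp [hδ.le])
  have i1 : Integrable fun t : ℝ => F (δ + I * t) := by
    refine integrable_of_le_exp_neg_abs (K := K)
      (hc.comp_continuous (by fun_prop) fun t => by simp [hδ.le]) fun t => ?_
    simpa using hK (δ + I * t) (by simp [hδ.le]) (by simp)
  have l0 := intervalIntegral_tendsto_integral i0 Filter.tendsto_neg_atTop_atBot Filter.tendsto_id
  have l1 := intervalIntegral_tendsto_integral i1 Filter.tendsto_neg_atTop_atBot Filter.tendsto_id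
  have hz : ∀ σ : ℝ, (σ = 1 ∨ σ = -1) → Filter.Tendsto
      (fun T : ℝ => ∫ x : ℝ in (0 : ℝ)..δ, F (x + (σ * T : ℝ) * I)) Filter.atTop (nhds 0) := by
    intro σ hσ
    have hb : ∀ T : ℝ, ‖∫ x : ℝ in (0 : ℝ)..δ, F (x + (σ * T : ℝ) * I)‖
        ≤ K * Real.exp (-|T|) * |δ - 0| := by
      intro T
      refine intervalIntegral.norm_integral_le_of_norm_le_const fun x hx => ?_
      rw [Set.uIoc_of_le hδ.le] at hx
      have h := hK (x + (σ * T : ℝ) * I) (by simpa using hx.1.le) (by simpa using hx.2)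
      have h2 : |σ * T| = |T| := by rcases hσ with rfl | rfl <;> simp
      have h3 : ((x : ℂ) + (σ * T : ℝ) * I).im = σ * T := by simp
      rwa [h3, h2] at h
    refine squeeze_zero_norm hb ?_
    have : Filter.Tendsto (fun T : ℝ => K * Real.exp (-|T|) * |δ - 0|) Filter.atTop
        (nhds (K * 0 * |δ - 0|)) :=
      ((Real.tendsto_exp_neg_atTop_nhds_zero.comp
        Filter.tendsto_abs_atTop_atTop).const_mul K).mul_const _
    simpa using this
  have hrect : ∀ T : ℝ, 0 < T →
      (∫ x : ℝ in (0 : ℝ)..δ, F (x + ((-1 : ℝ) * T : ℝ) * I))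
        - (∫ x : ℝ in (0 : ℝ)..δ, F (x + ((1 : ℝ) * T : ℝ) * I))
        + I • (∫ y : ℝ in (-T)..T, F (δ + I * y))
        - I • (∫ y : ℝ in (-T)..T, F (I * y)) = 0 := by
    intro T hT
    have h := Complex.integral_boundary_rect_eq_zero_of_continuousOn_of_differentiableOn F
      ((-T : ℝ) * I) (δ + (T : ℝ) * I)
      (hc.mono fun w hw => by
        have := hw.1
        simpa [Set.uIcc_of_le hδ.le] using this)
      (hd.mono fun w hw => by
        have := hw.1
        simpa [hδ.le] using this)
    simpa [mul_comm I] using h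
  have hlim := (((hz (-1) (by simp)).sub (hz 1 (by simp))).add (l1.const_smul I)).sub
    (l0.const_smul I)
  have hlim0 := hlim.congr' (f₂ := fun _ => (0 : ℂ)) (by
    filter_upwards [Filter.eventually_gt_atTop (0 : ℝ)] with T hT
    exact hrect T hT)
  have := tendsto_nhds_unique hlim0 tendsto_const_nhds
  simp only [sub_self, zero_add, smul_eq_mul, ← mul_sub] at this
  exact (sub_eq_zero.1 ((mul_eq_zero.1 this).resolve_left I_ne_zero)).symm

lemma integrable_prod_kernel {p q : ℝ → ℂ} (hp : Continuous p) (hq : Continuous q)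
    (hpd : ∀ a : ℝ, ∃ K : ℝ, ∀ t, ‖p t‖ ≤ K * Real.exp (-(a * |t|)))
    (hqd : ∀ a : ℝ, ∃ K : ℝ, ∀ t, ‖q t‖ ≤ K * Real.exp (-(a * |t|)))
    {k : ℝ → ℝ → ℂ} (hk : Continuous (Function.uncurry k)) {C b : ℝ}
    (hkb : ∀ t s, ‖k t s‖ ≤ C * (Real.exp (b * |t|) * Real.exp (b * |s|))) :
    Integrable (Function.uncurry fun t s => p t * (q s * k t s))
      ((volume : Measure ℝ).prod (volume : Measure ℝ)) := by
  have key : ∀ r : ℝ → ℂ, Continuous r →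
      (∀ a : ℝ, ∃ K : ℝ, ∀ t, ‖r t‖ ≤ K * Real.exp (-(a * |t|))) →
      Integrable fun t : ℝ => r t * (Real.exp (b * |t|) : ℂ) := by
    intro r hr hrd
    obtain ⟨K, hK⟩ := hrd (b + 1)
    refine integrable_of_le_exp_neg_abs (K := K) (by fun_prop) fun t => ?_
    rw [norm_mul, Complex.norm_real, Real.norm_of_nonneg (Real.exp_pos _).le]
    calc ‖r t‖ * Real.exp (b * |t|)
        ≤ K * Real.exp (-((b + 1) * |t|)) * Real.exp (b * |t|) := by gcongr; exact hK t
      _ = K * Real.exp (-|t|) := by rw [mul_assoc, ← Real.exp_add]; ring_nf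
  have h := (((key p hp hpd).mul_prod (key q hq hqd)).norm).const_mul C
  refine h.mono' ?_ (Filter.Eventually.of_forall ?_)
  · refine Continuous.aestronglyMeasurable ?_
    exact (hp.comp continuous_fst).mul ((hq.comp continuous_snd).mul hk)
  · rintro ⟨t, s⟩
    simp only [Function.uncurry_apply_pair, norm_mul, Complex.norm_real,
      Real.norm_of_nonneg (Real.exp_pos _).le]
    calc ‖p t‖ * (‖q s‖ * ‖k t s‖)
        ≤ ‖p t‖ * (‖q s‖ * (C * (Real.exp (b * |t|) * Real.exp (b * |s|)))) := by
          gcongr; exact hkb t s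
      _ = _ := by ring

/-- The entire function `s ↦ (e^{ξs} − 1)/s`. -/
noncomputable def expQuot (ξ : ℂ) : ℂ → ℂ := dslope (fun s => exp (ξ * s)) 0

lemma differentiable_expQuot (ξ : ℂ) : Differentiable ℂ (expQuot ξ) := by
  rw [← differentiableOn_univ]
  refine (Complex.differentiableOn_dslope Filter.univ_mem).2 ?_
  fun_prop

lemma expQuot_zero (ξ : ℂ) : expQuot ξ 0 = ξ := by
  have h : HasDerivAt (fun s : ℂ => exp (ξ * s)) (exp (ξ * 0) * (ξ * 1)) 0 :=
    ((hasDerivAt_id (0 : ℂ)).const_mul ξ).cexp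
  simp [expQuot, dslope_same, h.deriv]

lemma expQuot_of_ne (ξ : ℂ) {s : ℂ} (hs : s ≠ 0) : expQuot ξ s = (exp (ξ * s) - 1) / s := by
  simp [expQuot, dslope_of_ne _ hs, slope_def_field]

lemma norm_expQuot_le (ξ s : ℂ) : ‖expQuot ξ s‖ ≤ ‖ξ‖ * Real.exp (‖ξ‖ * ‖s‖) := by
  rcases eq_or_ne s 0 with rfl | hs
  · simp [expQuot_zero]
  · rw [expQuot_of_ne ξ hs, norm_div, div_le_iff₀ (norm_pos_iff.2 hs)]
    have h := Complex.norm_exp_sub_sum_le_norm_mul_exp (ξ * s) 1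
    simp only [Finset.range_one, Finset.sum_singleton, pow_zero, Nat.factorial_zero,
      Nat.cast_one, div_one, pow_one, norm_mul] at h
    linarith

lemma extIntegrand_eq (f : ℂ → ℂ) (ξ w₁ w₂ : ℂ) :
    extIntegrand f ξ w₁ w₂ = f w₁ * f w₂ * (exp (-(ξ * w₁)) * expQuot ξ (w₁ + w₂)) := by
  unfold extIntegrand
  split_ifs with h
  · have : w₂ = -w₁ := by linear_combination h
    rw [h, expQuot_zero, this]
    ring_nf
  · have : exp (ξ * w₂) = exp (-(ξ * w₁)) * exp (ξ * (w₁ + w₂)) := by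
      rw [← exp_add]
      ring_nf
    rw [expQuot_of_ne ξ h, this]
    ring

lemma norm_le_add_abs_im {δ : ℝ} {w : ℂ} (h0 : 0 ≤ w.re) (h1 : w.re ≤ δ) :
    ‖w‖ ≤ δ + |w.im| :=
  (Complex.norm_le_abs_re_add_abs_im w).trans (by rw [abs_of_nonneg h0]; gcongr)

lemma norm_exp_mul_le {ξ w : ℂ} {r : ℝ} (h : ‖w‖ ≤ r) : ‖exp (ξ * w)‖ ≤ Real.exp (‖ξ‖ * r) := by
  refine (Complex.norm_exp_le_exp_norm _).trans ?_
  rw [norm_mul]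
  gcongr

lemma SuperExpDecay.mul {δ : ℝ} {P Q : ℂ → ℂ} (hP : SuperExpDecay δ P) {C b : ℝ}
    (hQ : ∀ w : ℂ, 0 ≤ w.re → w.re ≤ δ → ‖Q w‖ ≤ C * Real.exp (b * |w.im|)) :
    SuperExpDecay δ fun w => P w * Q w := by
  intro a
  obtain ⟨K, hK⟩ := hP (a + b)
  refine ⟨K * C, fun w h0 h1 => ?_⟩
  rw [norm_mul]
  calc ‖P w‖ * ‖Q w‖
      ≤ (K * Real.exp (-((a + b) * |w.im|))) * (C * Real.exp (b * |w.im|)) :=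
        mul_le_mul (hK w h0 h1) (hQ w h0 h1) (norm_nonneg _)
          ((norm_nonneg _).trans (hK w h0 h1))
    _ = K * C * (Real.exp (-((a + b) * |w.im|)) * Real.exp (b * |w.im|)) := by ring
    _ = K * C * Real.exp (-(a * |w.im|)) := by rw [← Real.exp_add]; ring_nf

lemma SuperExpDecay.integral_shift {δ : ℝ} (hδ : 0 < δ) {P Q : ℂ → ℂ}
    (hP : SuperExpDecay δ P)
    (hc : ContinuousOn P {w : ℂ | 0 ≤ w.re ∧ w.re ≤ δ})
    (hd : DifferentiableOn ℂ P {w : ℂ | 0 < w.re ∧ w.re < δ})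
    (hQd : ∀ w : ℂ, 0 ≤ w.re → DifferentiableAt ℂ Q w) {C b : ℝ}
    (hQ : ∀ w : ℂ, 0 ≤ w.re → w.re ≤ δ → ‖Q w‖ ≤ C * Real.exp (b * |w.im|)) :
    ∫ t : ℝ, P (I * t) * Q (I * t) = ∫ t : ℝ, P (δ + I * t) * Q (δ + I * t) := by
  obtain ⟨K, hK⟩ := hP.mul hQ 1
  refine integral_vertical_shift (F := fun w => P w * Q w) hδ (K := K) ?_ ?_ ?_
  · exact hc.mul fun w hw => (hQd w hw.1).continuousAt.continuousWithinAt
  · exact hd.mul fun w hw => (hQd w hw.1.le).differentiableWithinAt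
  · simpa using hK

lemma le_norm_of_le_re {δ : ℝ} {w : ℂ} (h : δ ≤ w.re) : δ ≤ ‖w‖ :=
  h.trans ((le_abs_self _).trans (Complex.abs_re_le_norm w))

/-- The contour identity behind the functional equation. -/
theorem integral_contour_identity {δ : ℝ} (hδ : 0 < δ) {P : ℂ → ℂ} (hP : SuperExpDecay δ P)
    (hc : ContinuousOn P {w : ℂ | 0 ≤ w.re ∧ w.re ≤ δ})
    (hd : DifferentiableOn ℂ P {w : ℂ | 0 < w.re ∧ w.re < δ}) (ξ : ℂ) :
    ∫ t : ℝ, P (I * t) * ((exp (ξ * (I * t)) - exp (-(ξ * (I * t)))) *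
        ∫ s : ℝ, P (δ + I * s) / (I * t + (δ + I * s)))
      = ∫ t : ℝ, P (I * t) * ∫ s : ℝ, P (I * s) *
          (exp (-(ξ * (I * t))) * expQuot ξ (I * t + I * s)) := by
  have c0 : Continuous fun t : ℝ => P (I * t) :=
    hc.comp_continuous (by fun_prop) fun t => by simp [hδ.le]
  have c1 : Continuous fun t : ℝ => P (δ + I * t) :=
    hc.comp_continuous (by fun_prop) fun t => by simp [hδ.le]
  have d0 : ∀ a : ℝ, ∃ K : ℝ, ∀ t : ℝ, ‖P (I * t)‖ ≤ K * Real.exp (-(a * |t|)) := fun a => by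
    obtain ⟨K, hK⟩ := hP a
    exact ⟨K, fun t => by simpa using hK (I * t) (by simp) (by simp [hδ.le])⟩
  have d1 : ∀ a : ℝ, ∃ K : ℝ, ∀ t : ℝ, ‖P (δ + I * t)‖ ≤ K * Real.exp (-(a * |t|)) := fun a => by
    obtain ⟨K, hK⟩ := hP a
    exact ⟨K, fun t => by simpa using hK (δ + I * t) (by simp [hδ.le]) (by simp)⟩
  have n0 : ∀ t : ℝ, ‖I * (t : ℂ)‖ ≤ δ + |t| := fun t => by simp [hδ.le]
  have n1 : ∀ t : ℝ, ‖(δ : ℂ) + I * t‖ ≤ δ + |t| := fun t => by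
    simpa using norm_le_add_abs_im (w := (δ : ℂ) + I * t) (δ := δ) (by simp [hδ.le]) (by simp)
  have ne : ∀ {w : ℂ}, δ ≤ w.re → w ≠ 0 := fun h h0 => by
    rw [h0] at h
    exact absurd h (by simpa using hδ)
  -- the kernels
  set k₁ : ℂ → ℂ → ℂ := fun w₁ w₂ => (exp (ξ * w₁) - exp (ξ * w₂)) / (w₁ + w₂) with hk₁
  set k₂ : ℂ → ℂ → ℂ := fun w₁ w₂ => (exp (ξ * w₂) - exp (-(ξ * w₁))) / (w₁ + w₂) with hk₂
  have ee : ∀ {w : ℂ} {t : ℝ}, ‖w‖ ≤ δ + |t| →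
      ‖exp (ξ * w)‖ ≤ Real.exp (‖ξ‖ * δ) * Real.exp (‖ξ‖ * |t|) := fun h => by
    rw [← Real.exp_add, ← mul_add]
    exact norm_exp_mul_le h
  have one_le : ∀ t : ℝ, 1 ≤ Real.exp (‖ξ‖ * |t|) := fun t =>
    Real.one_le_exp (by positivity)
  have quot : ∀ {A B w : ℂ} {t s : ℝ}, δ ≤ w.re →
      ‖A‖ ≤ Real.exp (‖ξ‖ * δ) * Real.exp (‖ξ‖ * |t|) →
      ‖B‖ ≤ Real.exp (‖ξ‖ * δ) * Real.exp (‖ξ‖ * |s|) →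
      ‖(A - B) / w‖ ≤ 2 * Real.exp (‖ξ‖ * δ) / δ *
        (Real.exp (‖ξ‖ * |t|) * Real.exp (‖ξ‖ * |s|)) := by
    intro A B w t s hw hA hB
    rw [norm_div]
    have e0 := Real.exp_pos (‖ξ‖ * δ)
    have h1 : ‖A - B‖ ≤ 2 * Real.exp (‖ξ‖ * δ) *
        (Real.exp (‖ξ‖ * |t|) * Real.exp (‖ξ‖ * |s|)) := by
      have ht := one_le t
      have hs := one_le s
      have h2 : Real.exp (‖ξ‖ * |t|) ≤ Real.exp (‖ξ‖ * |t|) * Real.exp (‖ξ‖ * |s|) :=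
        le_mul_of_one_le_right (by linarith) hs
      have h3 : Real.exp (‖ξ‖ * |s|) ≤ Real.exp (‖ξ‖ * |t|) * Real.exp (‖ξ‖ * |s|) :=
        le_mul_of_one_le_left (by linarith) ht
      have h4 := mul_le_mul_of_nonneg_left h2 e0.le
      have h5 := mul_le_mul_of_nonneg_left h3 e0.le
      linarith [norm_sub_le A B]
    calc ‖A - B‖ / ‖w‖ ≤ (2 * Real.exp (‖ξ‖ * δ) *
        (Real.exp (‖ξ‖ * |t|) * Real.exp (‖ξ‖ * |s|))) / δ := by
          gcongr
          exact le_norm_of_le_re hw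
      _ = _ := by ring
  have cont : ∀ {p q : ℝ → ℂ}, Continuous p → Continuous q → (∀ t s, δ ≤ (p t + q s).re) →
      ∀ {k : ℂ → ℂ → ℂ}, Continuous (Function.uncurry k) →
      Continuous (Function.uncurry fun t s => k (p t) (q s) / (p t + q s)) := by
    intro p q hp hq hpq k hk
    have h := hk.comp ((hp.comp continuous_fst).prodMk (hq.comp continuous_snd) :
      Continuous fun z : ℝ × ℝ => (p z.1, q z.2))
    exact h.div ((hp.comp continuous_fst).add (hq.comp continuous_snd)) fun z => ne (hpq _ _)
  have cl0 : Continuous fun t : ℝ => I * (t : ℂ) := by fun_prop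
  have cl1 : Continuous fun t : ℝ => (δ : ℂ) + I * (t : ℂ) := by fun_prop
  have j₁ := integrable_prod_kernel c0 c1 d0 d1
    (k := fun t s => k₁ (I * t) (δ + I * s))
    (cont cl0 cl1 (fun t s => by simp) (k := fun w₁ w₂ => exp (ξ * w₁) - exp (ξ * w₂))
      (by simp only [Function.uncurry_def]; fun_prop))
    (fun t s => quot (by simp) (ee (n0 t)) (ee (n1 s)))
  have j₂ := integrable_prod_kernel c0 c1 d0 d1
    (k := fun t s => k₂ (I * t) (δ + I * s))
    (cont cl0 cl1 (fun t s => by simp) (k := fun w₁ w₂ => exp (ξ * w₂) - exp (-(ξ * w₁)))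
      (by simp only [Function.uncurry_def]; fun_prop))
    (fun t s => by
      have h := quot (w := I * t + (δ + I * s)) (by simp) (ee (n1 s))
        (ee (w := -(I * t)) (t := t) (by rw [norm_neg]; exact n0 t))
      rw [mul_neg] at h
      rw [mul_comm (Real.exp (‖ξ‖ * |t|))]
      exact h)
  have j₃ := integrable_prod_kernel c1 c1 d1 d1
    (k := fun t s => k₁ (δ + I * t) (δ + I * s))
    (cont cl1 cl1 (fun t s => by simp [hδ.le]) (k := fun w₁ w₂ => exp (ξ * w₁) - exp (ξ * w₂))
      (by simp only [Function.uncurry_def]; fun_prop))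
    (fun t s => quot (by simp [hδ.le]) (ee (n1 t)) (ee (n1 s)))
  -- the antisymmetric double integral vanishes
  have hanti : ∫ t : ℝ, ∫ s : ℝ, P (δ + I * t) * (P (δ + I * s) * k₁ (δ + I * t) (δ + I * s))
      = 0 := by
    have h := integral_integral_swap j₃
    have h' : ∫ s : ℝ, ∫ t : ℝ, P (δ + I * t) * (P (δ + I * s) * k₁ (δ + I * t) (δ + I * s))
        = -∫ s : ℝ, ∫ t : ℝ, P (δ + I * s) * (P (δ + I * t) * k₁ (δ + I * s) (δ + I * t)) := by
      simp only [← integral_neg]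
      refine integral_congr_ae (Filter.Eventually.of_forall fun s => ?_)
      refine integral_congr_ae (Filter.Eventually.of_forall fun t => ?_)
      simp only [hk₁]
      rw [add_comm ((δ : ℂ) + I * s)]
      ring
    rw [h'] at h
    exact self_eq_neg.1 h
  have hzero : ∫ t : ℝ, ∫ s : ℝ, P (I * t) * (P (δ + I * s) * k₁ (I * t) (δ + I * s)) = 0 := by
    rw [integral_integral_swap j₁]
    have hs : ∀ s : ℝ, ∫ t : ℝ, P (I * t) * (P (δ + I * s) * k₁ (I * t) (δ + I * s))
        = ∫ t : ℝ, P (δ + I * t) * (P (δ + I * s) * k₁ (δ + I * t) (δ + I * s)) := by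
      intro s
      refine hP.integral_shift hδ hc hd
        (Q := fun w => P (δ + I * s) * k₁ w (δ + I * s))
        (C := ‖P (δ + I * s)‖ * (2 * Real.exp (‖ξ‖ * δ) / δ * Real.exp (‖ξ‖ * |s|)))
        (b := ‖ξ‖) ?_ ?_
      · intro w hw
        have : w + ((δ : ℂ) + I * s) ≠ 0 := ne (by simpa using hw)
        simp only [hk₁]
        fun_prop (disch := assumption)
      · intro w h0 h1
        rw [norm_mul]
        have := quot (w := w + (δ + I * s)) (by simpa using h0)
          (ee (norm_le_add_abs_im h0 h1)) (ee (n1 s))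
        calc ‖P (δ + I * s)‖ * ‖k₁ w (δ + I * s)‖ ≤ ‖P (δ + I * s)‖ * _ :=
              mul_le_mul_of_nonneg_left this (norm_nonneg _)
          _ = _ := by ring
    simp only [hs]
    rw [← integral_integral_swap j₃, hanti]
  have hright : ∀ t : ℝ, ∫ s : ℝ, P (I * s) * (exp (-(ξ * (I * t))) * expQuot ξ (I * t + I * s))
      = ∫ s : ℝ, P (δ + I * s) * k₂ (I * t) (δ + I * s) := by
    intro t
    rw [hP.integral_shift hδ hc hd
      (Q := fun w => exp (-(ξ * (I * t))) * expQuot ξ (I * t + w))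
      (C := ‖exp (-(ξ * (I * t)))‖ * (‖ξ‖ * Real.exp (‖ξ‖ * (|t| + δ)))) (b := ‖ξ‖)
      (fun w _ => ((differentiable_expQuot ξ).comp
        (differentiable_id.const_add (I * (t : ℂ)))).differentiableAt.const_mul _) ?_]
    · refine integral_congr_ae (Filter.Eventually.of_forall fun s => ?_)
      have h0 : I * (t : ℂ) + (δ + I * s) ≠ 0 := ne (by simp)
      simp only [hk₂]
      rw [expQuot_of_ne ξ h0, ← mul_div_assoc (exp _), mul_sub, ← exp_add]
      ring_nf
    · intro w h0 h1
      rw [norm_mul, mul_assoc, mul_assoc, ← Real.exp_add, ← mul_add]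
      have h2 : ‖I * (t : ℂ) + w‖ ≤ |t| + δ + |w.im| := by
        refine (norm_add_le _ _).trans ?_
        have := norm_le_add_abs_im h0 h1
        simp only [norm_mul, norm_I, one_mul, norm_real, Real.norm_eq_abs]
        linarith
      have h3 := norm_expQuot_le ξ (I * t + w)
      refine mul_le_mul_of_nonneg_left (h3.trans ?_) (norm_nonneg _)
      gcongr
  have hsplit : ∀ t : ℝ, P (I * t) * ((exp (ξ * (I * t)) - exp (-(ξ * (I * t)))) *
        ∫ s : ℝ, P (δ + I * s) / (I * t + (δ + I * s)))
      = ∫ s : ℝ, (P (I * t) * (P (δ + I * s) * k₁ (I * t) (δ + I * s)) +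
          P (I * t) * (P (δ + I * s) * k₂ (I * t) (δ + I * s))) := by
    intro t
    rw [← integral_const_mul, ← integral_const_mul]
    refine integral_congr_ae (Filter.Eventually.of_forall fun s => ?_)
    simp only [hk₁, hk₂]
    ring
  simp only [hsplit]
  simp only [hright, ← integral_const_mul]
  have hadd := integral_integral_add j₁ j₂
  simp only [Function.uncurry_apply_pair] at hadd
  rw [hzero, zero_add] at hadd
  exact hadd

lemma norm_Gamma_le_Gamma_re {s : ℂ} (hs : 0 < s.re) : ‖Gamma s‖ ≤ Real.Gamma s.re := by
  rw [Gamma_eq_integral hs, Real.Gamma_eq_integral hs, GammaIntegral]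
  refine (norm_integral_le_integral_norm _).trans (le_of_eq ?_)
  refine setIntegral_congr_fun measurableSet_Ioi fun x hx => ?_
  rw [Set.mem_Ioi] at hx
  simp [Complex.norm_cpow_eq_rpow_re_of_pos hx, Complex.norm_exp]

lemma exists_norm_Gamma_le {x δ : ℝ} (hx : δ < x) (hδ : 0 ≤ δ) :
    ∃ M : ℝ, ∀ w : ℂ, 0 ≤ w.re → w.re ≤ δ → ‖Gamma (x + w)‖ ≤ M ∧ ‖Gamma (x - w)‖ ≤ M := by
  have hc : ContinuousOn Real.Gamma (Set.Icc (x - δ) (x + δ)) := fun y hy =>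
    (Real.differentiableAt_Gamma fun m hm => by
      have := hy.1
      have h0 : (0 : ℝ) ≤ m := m.cast_nonneg
      linarith).continuousAt.continuousWithinAt
  obtain ⟨M, hM⟩ := isCompact_Icc.exists_bound_of_continuousOn hc
  refine ⟨M, fun w h0 h1 => ⟨?_, ?_⟩⟩
  · refine (norm_Gamma_le_Gamma_re (by simp; linarith)).trans ((le_abs_self _).trans (hM _ ?_))
    simp only [add_re, ofReal_re]
    constructor <;> linarith
  · refine (norm_Gamma_le_Gamma_re (by simp; linarith)).trans ((le_abs_self _).trans (hM _ ?_))
    simp only [sub_re, ofReal_re]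
    constructor <;> linarith

lemma inv_Gamma_mul_Gamma_neg (z : ℂ) :
    (Gamma z * Gamma (-z))⁻¹ = -z * sin (Real.pi * z) / Real.pi := by
  rcases eq_or_ne z 0 with rfl | hz
  · simp
  · have h := Complex.Gamma_mul_Gamma_one_sub z
    rw [show (1 : ℂ) - z = -z + 1 by ring, Complex.Gamma_add_one _ (neg_ne_zero.2 hz)] at h
    have h2 : Gamma z * Gamma (-z) = Real.pi / sin (Real.pi * z) / (-z) := by
      rw [eq_div_iff (neg_ne_zero.2 hz), ← h]
      ring
    rw [h2, inv_div, div_div_eq_mul_div]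

lemma Psi_eq (u v L : ℝ) (w : ℂ) :
    Psi u v L w = exp (L * w ^ 2) * Gamma (u + w) * Gamma (u - w) * Gamma (v + w) *
      Gamma (v - w) * (-(2 * w) * sin (Real.pi * (2 * w)) / Real.pi) := by
  rw [← inv_Gamma_mul_Gamma_neg, Psi]
  ring

lemma Psi_neg (u v L : ℝ) (w : ℂ) : Psi u v L (-w) = Psi u v L w := by
  simp only [Psi, mul_neg, neg_neg, sub_neg_eq_add, ← sub_eq_add_neg, neg_sq]
  ring

lemma differentiableAt_Psi {u v : ℝ} (L : ℝ) {w : ℂ} (hu : |w.re| < u) (hv : |w.re| < v) :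
    DifferentiableAt ℂ (Psi u v L) w := by
  rw [show Psi u v L = _ from funext (Psi_eq u v L)]
  have hG : ∀ s : ℂ, 0 < s.re → DifferentiableAt ℂ Gamma s := fun s hs =>
    Complex.differentiableAt_Gamma s fun m hm => by
      rw [hm] at hs
      have h0 : (0 : ℝ) ≤ m := m.cast_nonneg
      simp at hs
      linarith
  rw [abs_lt] at hu hv
  have ha : ∀ x : ℝ, -x < w.re ∧ w.re < x →
      DifferentiableAt ℂ (fun w : ℂ => Gamma (x + w)) w := fun x hx =>
    (hG (x + w) (by simp; linarith)).comp w (by fun_prop)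
  have hs : ∀ x : ℝ, -x < w.re ∧ w.re < x →
      DifferentiableAt ℂ (fun w : ℂ => Gamma (x - w)) w := fun x hx =>
    (hG (x - w) (by simp; linarith)).comp w (by fun_prop)
  have h1 := ha u hu
  have h2 := hs u hu
  have h3 := ha v hv
  have h4 := hs v hv
  fun_prop

lemma superExpDecay_exp_sq {L δ : ℝ} (hL : 0 < L) :
    SuperExpDecay δ fun w => exp (L * w ^ 2) := by
  intro a
  refine ⟨Real.exp (L * δ ^ 2 + a ^ 2 / (4 * L)), fun w h0 h1 => ?_⟩
  rw [Complex.norm_exp, ← Real.exp_add]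
  refine Real.exp_le_exp.2 ?_
  have h : ((L : ℂ) * w ^ 2).re = L * (w.re ^ 2 - w.im ^ 2) := by
    simp [sq]
  rw [h]
  have h2 : L * w.re ^ 2 ≤ L * δ ^ 2 := by gcongr
  have h3 : a ^ 2 / (4 * L) - a * |w.im| + L * w.im ^ 2
      = L * (|w.im| - a / (2 * L)) ^ 2 := by
    rw [← sq_abs w.im]
    field_simp
    ring
  have h4 : 0 ≤ L * (|w.im| - a / (2 * L)) ^ 2 := by positivity
  linarith

lemma superExpDecay_Psi {u v L δ : ℝ} (hL : 0 < L) (hδ : 0 ≤ δ) (hu : δ < u) (hv : δ < v) :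
    SuperExpDecay δ (Psi u v L) := by
  obtain ⟨M, hM⟩ := exists_norm_Gamma_le hu hδ
  obtain ⟨N, hN⟩ := exists_norm_Gamma_le hv hδ
  rw [show Psi u v L = _ from funext (Psi_eq u v L)]
  refine SuperExpDecay.mul (C := 2 * Real.exp δ * Real.exp (2 * Real.pi * δ) / Real.pi)
    (b := 1 + 2 * Real.pi)
    (((((superExpDecay_exp_sq hL).mul (C := M) (b := 0) ?_).mul (C := M) (b := 0) ?_).mul
      (C := N) (b := 0) ?_).mul (C := N) (b := 0) ?_) ?_
  · simpa using fun w h0 h1 => (hM w h0 h1).1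
  · simpa using fun w h0 h1 => (hM w h0 h1).2
  · simpa using fun w h0 h1 => (hN w h0 h1).1
  · simpa using fun w h0 h1 => (hN w h0 h1).2
  · intro w h0 h1
    have hw := norm_le_add_abs_im h0 h1
    have hw1 : ‖w‖ ≤ Real.exp (δ + |w.im|) := by
      linarith [Real.add_one_le_exp (δ + |w.im|)]
    have hsin : ‖sin (Real.pi * (2 * w))‖ ≤ Real.exp (2 * Real.pi * (δ + |w.im|)) := by
      have hn : ‖(Real.pi : ℂ) * (2 * w)‖ ≤ 2 * Real.pi * (δ + |w.im|) := by
        simp only [norm_mul, norm_real, Real.norm_eq_abs, abs_of_pos Real.pi_pos, norm_ofNat]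
        nlinarith [Real.pi_pos]
      have e1 := (Complex.norm_exp_le_exp_norm (-(Real.pi * (2 * w)) * I)).trans
        (Real.exp_le_exp.2 ((by simp : ‖-((Real.pi : ℂ) * (2 * w)) * I‖
          = ‖(Real.pi : ℂ) * (2 * w)‖).le.trans hn))
      have e2 := (Complex.norm_exp_le_exp_norm ((Real.pi * (2 * w)) * I)).trans
        (Real.exp_le_exp.2 ((by simp : ‖((Real.pi : ℂ) * (2 * w)) * I‖
          = ‖(Real.pi : ℂ) * (2 * w)‖).le.trans hn))
      rw [Complex.sin, norm_div, norm_mul, norm_I, mul_one, norm_ofNat, div_le_iff₀ two_pos]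
      refine (norm_sub_le _ _).trans ?_
      linarith
    rw [norm_div, norm_mul, norm_neg, norm_mul, norm_ofNat, norm_real, Real.norm_eq_abs,
      abs_of_pos Real.pi_pos]
    calc 2 * ‖w‖ * ‖sin (Real.pi * (2 * w))‖ / Real.pi
        ≤ 2 * Real.exp (δ + |w.im|) * Real.exp (2 * Real.pi * (δ + |w.im|)) / Real.pi := by
          gcongr
      _ = _ := by
          rw [mul_add, Real.exp_add, Real.exp_add, add_mul, Real.exp_add, one_mul]
          ring

lemma norm_le_exp_of_polynomial_bound {g : ℂ → ℂ} {C : ℝ} {m : ℕ} {δ : ℝ} {w : ℂ}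
    (h0 : 0 ≤ w.re) (h1 : w.re ≤ δ) (hg : ‖g w‖ ≤ C * (1 + ‖w‖) ^ m) :
    ‖g w‖ ≤ |C| * Real.exp (m * δ) * Real.exp (m * |w.im|) := by
  refine hg.trans ?_
  have h2 : 1 + ‖w‖ ≤ Real.exp (δ + |w.im|) := by
    linarith [Real.add_one_le_exp (δ + |w.im|), norm_le_add_abs_im h0 h1]
  calc C * (1 + ‖w‖) ^ m ≤ |C| * Real.exp (δ + |w.im|) ^ m := by
        gcongr
        exact le_abs_self C
    _ = _ := by rw [← Real.exp_nat_mul, mul_add, Real.exp_add]; ring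

lemma SuperExpDecay.integrable_mul_exp_sub_exp {δ : ℝ} (hδ : 0 < δ) {P : ℂ → ℂ}
    (hP : SuperExpDecay δ P) (hc : ContinuousOn P {w : ℂ | 0 ≤ w.re ∧ w.re ≤ δ}) (ξ : ℂ) :
    Integrable fun t : ℝ => P (I * t) * (exp (ξ * (I * t)) - exp (-(ξ * (I * t)))) := by
  obtain ⟨K, hK⟩ := hP.mul (Q := fun w => exp (ξ * w) - exp (-(ξ * w)))
    (C := 2 * Real.exp (‖ξ‖ * δ)) (b := ‖ξ‖) (fun w h0 h1 => by
      have hw := norm_le_add_abs_im h0 h1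
      have e1 := norm_exp_mul_le (ξ := ξ) hw
      have e2 := norm_exp_mul_le (ξ := ξ) (w := -w) ((norm_neg w).le.trans hw)
      rw [mul_neg] at e2
      refine (norm_sub_le _ _).trans ?_
      rw [mul_assoc, ← Real.exp_add, ← mul_add]
      linarith) 1
  have c0 : Continuous fun t : ℝ => P (I * t) :=
    hc.comp_continuous (by fun_prop) fun t => by simp [hδ.le]
  refine integrable_of_le_exp_neg_abs (K := K) (c0.mul (by fun_prop)) fun t => ?_
  simpa using hK (I * t) (by simp) (by simp [hδ.le])

lemma integral_eq_zero_of_odd {F : ℝ → ℂ} (hF : ∀ t, F (-t) = -F t) : ∫ t, F t = 0 := by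
  have h := integral_neg_eq_self F volume
  simp only [hF, integral_neg] at h
  exact self_eq_neg.1 h.symm

/-- If `f` satisfies `f(w₁) = 2n ∫_{δ+iℝ} ν(dw₂) f(w₁)f(w₂)/(w₁+w₂) + h(w₁)` on the
strip, with `h` even on `iℝ`, then `f` satisfies the functional equation
`∫_{iℝ} ν(dw) f(w)(e^{ξw} − e^{−ξw})`
`= 2n ∫_{iℝ} ν(dw₁) ∫_{iℝ} ν(dw₂) f(w₁)f(w₂)(e^{ξw₂} − e^{−ξw₁})/(w₁+w₂)`. -/
theorem functional_equation_of_resolvent_equation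
    (u v L : ℝ) (hu : 0 < u) (hv : 0 < v) (hL : 0 < L)
    (Z : ℝ) (hZpos : 0 < Z)
    (hZ : (Z : ℂ) = ∫ x : ℝ, Psi u v L (Complex.I * x) / (2 * Real.pi))
    (δ : ℝ) (hδ0 : 0 < δ) (hδ : δ < min u (min v 1))
    (n : ℂ) (f h : ℂ → ℂ)
    (hfc : ContinuousOn f strip) (hhc : ContinuousOn h strip)
    (hfd : DifferentiableOn ℂ f {w : ℂ | 0 < w.re ∧ w.re < 1})
    (hhd : DifferentiableOn ℂ h {w : ℂ | 0 < w.re ∧ w.re < 1})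
    (hfb : ∃ C : ℝ, ∃ m : ℕ, ∀ w ∈ strip, ‖f w‖ ≤ C * (1 + ‖w‖) ^ m)
    (hhb : ∃ C : ℝ, ∃ m : ℕ, ∀ w ∈ strip, ‖h w‖ ≤ C * (1 + ‖w‖) ^ m)
    (hsym : ∀ t : ℝ, h (-(Complex.I * t)) = h (Complex.I * t))
    (heq : ∀ w₁ ∈ strip,
      f w₁ = 2 * n * ((1 / (Z : ℂ)) *
          ∫ t : ℝ, Psi u v L ((δ : ℂ) + Complex.I * t) *
            (f w₁ * f ((δ : ℂ) + Complex.I * t) / (w₁ + ((δ : ℂ) + Complex.I * t))) /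
            (2 * Real.pi))
        + h w₁) :
    ∀ ξ : ℂ,
      (1 / (Z : ℂ)) *
          ∫ t : ℝ, Psi u v L (Complex.I * t) *
            (f (Complex.I * t) *
              (Complex.exp (ξ * (Complex.I * t)) - Complex.exp (-(ξ * (Complex.I * t))))) /
            (2 * Real.pi)
        = 2 * n * ((1 / (Z : ℂ)) *
            ∫ t₁ : ℝ, Psi u v L (Complex.I * t₁) *
              ((1 / (Z : ℂ)) *
                ∫ t₂ : ℝ, Psi u v L (Complex.I * t₂) *
                  extIntegrand f ξ (Complex.I * t₁) (Complex.I * t₂) / (2 * Real.pi)) /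
              (2 * Real.pi)) := by
  have hδu : δ < u := hδ.trans_le (min_le_left _ _)
  have hδv : δ < v := hδ.trans_le ((min_le_right _ _).trans (min_le_left _ _))
  have hδ1 : δ < 1 := hδ.trans_le ((min_le_right _ _).trans (min_le_right _ _))
  intro ξ
  have hsub : {w : ℂ | 0 ≤ w.re ∧ w.re ≤ δ} ⊆ strip := fun w hw => ⟨hw.1, hw.2.trans hδ1.le⟩
  have hΨd : ∀ w : ℂ, 0 ≤ w.re → w.re ≤ δ → DifferentiableAt ℂ (Psi u v L) w := fun w h0 h1 =>
    differentiableAt_Psi L (by rw [abs_of_nonneg h0]; linarith)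
      (by rw [abs_of_nonneg h0]; linarith)
  have hΨc : ContinuousOn (Psi u v L) {w : ℂ | 0 ≤ w.re ∧ w.re ≤ δ} := fun w hw =>
    (hΨd w hw.1 hw.2).continuousAt.continuousWithinAt
  have hΨ := superExpDecay_Psi hL hδ0.le hδu hδv
  have hmul : ∀ g : ℂ → ℂ, (∃ C : ℝ, ∃ m : ℕ, ∀ w ∈ strip, ‖g w‖ ≤ C * (1 + ‖w‖) ^ m) →
      SuperExpDecay δ fun w => Psi u v L w * g w := by
    rintro g ⟨C, m, hg⟩
    exact hΨ.mul fun w h0 h1 => norm_le_exp_of_polynomial_bound h0 h1 (hg w (hsub ⟨h0, h1⟩))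
  have hP := hmul f hfb
  have hPc := hΨc.mul (hfc.mono hsub)
  have hPd : DifferentiableOn ℂ (fun w => Psi u v L w * f w) {w : ℂ | 0 < w.re ∧ w.re < δ} :=
    fun w hw => (hΨd w hw.1.le hw.2.le).differentiableWithinAt.mul
      ((hfd.mono fun z hz => ⟨hz.1, hz.2.trans hδ1⟩) w hw)
  have key := integral_contour_identity hδ0 hP hPc hPd ξ
  have intP := hP.integrable_mul_exp_sub_exp hδ0 hPc ξ
  have intH := (hmul h hhb).integrable_mul_exp_sub_exp hδ0 (hΨc.mul (hhc.mono hsub)) ξ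
  have hodd : ∫ t : ℝ, Psi u v L (I * t) * h (I * t) *
      (exp (ξ * (I * t)) - exp (-(ξ * (I * t)))) = 0 := by
    refine integral_eq_zero_of_odd fun t => ?_
    rw [ofReal_neg, mul_neg, Psi_neg, hsym, mul_neg, neg_neg]
    ring
  have hf : ∀ t : ℝ, f (I * t) = 2 * n * (1 / Z) / (2 * Real.pi) * (f (I * t) *
      ∫ s : ℝ, Psi u v L (δ + I * s) * f (δ + I * s) / (I * t + (δ + I * s))) + h (I * t) := by
    intro t
    have h1 := heq (I * t) (by simp [strip])
    rw [integral_div] at h1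
    have h2 : ∫ s : ℝ, Psi u v L (δ + I * s) *
          (f (I * t) * f (δ + I * s) / (I * t + (δ + I * s)))
        = f (I * t) * ∫ s : ℝ, Psi u v L (δ + I * s) * f (δ + I * s) /
          (I * t + (δ + I * s)) := by
      rw [← integral_const_mul]
      congr 1 with s
      ring
    rw [h2] at h1
    linear_combination h1
  have hA : ∫ t : ℝ, Psi u v L (I * t) * f (I * t) *
        (exp (ξ * (I * t)) - exp (-(ξ * (I * t))))
      = 2 * n * (1 / Z) / (2 * Real.pi) * ∫ t : ℝ, Psi u v L (I * t) * f (I * t) *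
        ((exp (ξ * (I * t)) - exp (-(ξ * (I * t)))) *
          ∫ s : ℝ, Psi u v L (δ + I * s) * f (δ + I * s) / (I * t + (δ + I * s))) := by
    rw [← sub_zero (∫ t : ℝ, _ * _), ← hodd, ← integral_sub intP intH, ← integral_const_mul]
    congr 1 with t
    linear_combination (Psi u v L (I * t) *
      (exp (ξ * (I * t)) - exp (-(ξ * (I * t))))) * hf t
  rw [key] at hA
  have hL' : ∫ t : ℝ, Psi u v L (I * t) * (f (I * t) *
        (exp (ξ * (I * t)) - exp (-(ξ * (I * t))))) / (2 * Real.pi)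
      = (∫ t : ℝ, Psi u v L (I * t) * f (I * t) *
        (exp (ξ * (I * t)) - exp (-(ξ * (I * t))))) / (2 * Real.pi) := by
    rw [← integral_div]
    congr 1 with t
    ring
  have hin : ∀ t : ℝ, ∫ s : ℝ, Psi u v L (I * s) *
        extIntegrand f ξ (I * t) (I * s) / (2 * Real.pi)
      = f (I * t) / (2 * Real.pi) * ∫ s : ℝ, Psi u v L (I * s) * f (I * s) *
          (exp (-(ξ * (I * t))) * expQuot ξ (I * t + I * s)) := by
    intro t
    rw [← integral_const_mul]
    congr 1 with s
    rw [extIntegrand_eq]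
    ring
  have hR : ∫ t : ℝ, Psi u v L (I * t) * (1 / (Z : ℂ) * ∫ s : ℝ, Psi u v L (I * s) *
        extIntegrand f ξ (I * t) (I * s) / (2 * Real.pi)) / (2 * Real.pi)
      = 1 / (Z : ℂ) / (2 * Real.pi) / (2 * Real.pi) *
        ∫ t : ℝ, Psi u v L (I * t) * f (I * t) * ∫ s : ℝ, Psi u v L (I * s) * f (I * s) *
          (exp (-(ξ * (I * t))) * expQuot ξ (I * t + I * s)) := by
    rw [← integral_const_mul]
    congr 1 with t
    rw [hin]
    ring
  rw [hL', hR, hA]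
  ring
end

section
/- Let I be a finite index set, q : I → ℂ, ρ : I → ℂ, and c ∈ ℂ with c ≠ 0. Assume q_α + q_β + c ≠ 0 for all α, β ∈ I, and that for every β ∈ I one has Σ_{α∈I} ρ_α/(q_α + q_β + c) = 1/c. Define L(z) = Σ_{α∈I} ρ_α e^{q_α z}. Then for every w ∈ ℂ, ∫₀¹ w · e^{−c t w/2} L(−tw) · e^{c(1−t)w/2} L((1−t)w) dt = (1/c)(e^{cw/2}L(w) − e^{−cw/2}L(−w)). -/
open Finset intervalIntegral

/-- The integral of `w e^{a − s t w}` over `t ∈ [0, 1]`, for `s ≠ 0`. -/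
theorem integral_mul_cexp_sub_mul (a w : ℂ) {s : ℂ} (hs : s ≠ 0) :
    (∫ t in (0:ℝ)..1, w * Complex.exp (a - s * (t : ℂ) * w))
      = (Complex.exp a - Complex.exp (a - s * w)) / s := by
  have hderiv : ∀ t : ℝ, HasDerivAt (fun t : ℝ => -Complex.exp (a - s * (t : ℂ) * w) / s)
      (w * Complex.exp (a - s * (t : ℂ) * w)) t := by
    intro t
    have h := (((((Complex.ofRealCLM.hasDerivAt (x := t)).const_mul s).mul_const w).const_sub
      a).cexp.neg).div_const s
    refine h.congr_deriv ?_
    simp only [Complex.ofRealCLM_apply, Complex.ofReal_one]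
    field_simp
  rw [integral_eq_sub_of_hasDerivAt (fun t _ => hderiv t)
    (Continuous.intervalIntegrable (by fun_prop) _ _)]
  simp only [Complex.ofReal_one, Complex.ofReal_zero, mul_one, mul_zero, zero_mul, sub_zero]
  ring

/-- Integral identity for the exponential sum `L(z) = Σ_α ρ_α e^{q_α z}` built from
weights satisfying `Σ_α ρ_α/(q_α + q_β + c) = 1/c`:
`∫₀^w e^{−cz/2}L(−z) e^{c(w−z)/2}L(w−z) dz = (1/c)(e^{cw/2}L(w) − e^{−cw/2}L(−w))`,
the integral being taken along the segment from `0` to `w`, parametrized by `z = tw`. -/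
theorem exponential_sum_integral_equation (ι : Type*) [Fintype ι]
    (q ρ : ι → ℂ) (c : ℂ) (hc : c ≠ 0)
    (hpole : ∀ α β : ι, q α + q β + c ≠ 0)
    (hsum : ∀ β : ι, ∑ α : ι, ρ α / (q α + q β + c) = 1 / c)
    (L : ℂ → ℂ) (hL : ∀ z, L z = ∑ α : ι, ρ α * Complex.exp (q α * z)) :
    ∀ w : ℂ,
      (∫ t in (0:ℝ)..1,
          w * Complex.exp (-c * (t : ℂ) * w / 2) * L (-(t : ℂ) * w) *
            Complex.exp (c * (1 - (t : ℂ)) * w / 2) * L ((1 - (t : ℂ)) * w))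
        = (1 / c) * (Complex.exp (c * w / 2) * L w - Complex.exp (-c * w / 2) * L (-w)) := by
  intro w
  have hintegrand : ∀ t : ℝ,
      w * Complex.exp (-c * (t : ℂ) * w / 2) * L (-(t : ℂ) * w) *
          Complex.exp (c * (1 - (t : ℂ)) * w / 2) * L ((1 - (t : ℂ)) * w)
        = ∑ α : ι, ∑ β : ι, ρ α * ρ β *
            (w * Complex.exp ((c * w / 2 + q β * w) - (q α + q β + c) * (t : ℂ) * w)) := by
    intro t
    have hexp : ∀ α β : ι,
        Complex.exp ((c * w / 2 + q β * w) - (q α + q β + c) * (t : ℂ) * w)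
          = Complex.exp (-c * (t : ℂ) * w / 2) * Complex.exp (q α * (-(t : ℂ) * w)) *
            Complex.exp (c * (1 - (t : ℂ)) * w / 2) *
            Complex.exp (q β * ((1 - (t : ℂ)) * w)) := by
      intro α β
      simp only [← Complex.exp_add]
      congr 1
      ring
    rw [hL, hL, mul_sum, sum_comm]
    refine sum_congr rfl fun β _ => ?_
    rw [mul_sum, sum_mul, sum_mul]
    refine sum_congr rfl fun α _ => ?_
    rw [hexp]
    ring
  have hfirst : ∑ α : ι, ∑ β : ι, ρ α * ρ β *
      (Complex.exp (c * w / 2 + q β * w) / (q α + q β + c))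
        = (1 / c) * (Complex.exp (c * w / 2) * L w) := by
    rw [sum_comm, hL, mul_sum, mul_sum]
    refine sum_congr rfl fun β _ => ?_
    rw [← hsum β, sum_mul]
    refine sum_congr rfl fun α _ => ?_
    rw [Complex.exp_add]
    ring
  have hsecond : ∑ α : ι, ∑ β : ι, ρ α * ρ β *
      (Complex.exp (-c * w / 2 + q α * -w) / (q α + q β + c))
        = (1 / c) * (Complex.exp (-c * w / 2) * L (-w)) := by
    rw [hL, mul_sum, mul_sum]
    refine sum_congr rfl fun α _ => ?_
    rw [← hsum α, sum_mul]
    refine sum_congr rfl fun β _ => ?_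
    rw [Complex.exp_add, add_comm (q β) (q α)]
    ring
  simp_rw [hintegrand]
  rw [integral_finsetSum fun α _ => Continuous.intervalIntegrable (by fun_prop) _ _, mul_sub,
    ← hfirst, ← hsecond, ← sum_sub_distrib]
  refine sum_congr rfl fun α _ => ?_
  rw [integral_finsetSum fun β _ => Continuous.intervalIntegrable (by fun_prop) _ _,
    ← sum_sub_distrib]
  refine sum_congr rfl fun β _ => ?_
  rw [integral_const_mul, integral_mul_cexp_sub_mul _ _ (hpole α β),
    show c * w / 2 + q β * w - (q α + q β + c) * w = -c * w / 2 + q α * -w by ring]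
  ring
end

section
/- Let m ≥ 1, let q₁, …, q_m ∈ ℂ be pairwise distinct, and let c ∈ ℂ with c ≠ 0 and q_α − q_γ + c ≠ 0 for all α, γ ∈ {1,…,m}. Define ρ_α = Π_{β≠α} (q_α − q_β + c)/(q_α − q_β). Then for every γ ∈ {1,…,m}, Σ_{α=1}^{m} ρ_α/(q_α − q_γ + c) = 1/c. -/
open Finset

/-- The divided difference at `#s` distinct nodes `v` of the monic polynomial
`∏ (X - w k)` of degree `#s - 1` is `1`. -/
theorem sum_prod_erase_sub_div_prod_erase_sub {ι F : Type*} [DecidableEq ι] [Field F]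
    {s : Finset ι} {v : ι → F} (hv : Set.InjOn v s) (w : ι → F) {j : ι} (hj : j ∈ s) :
    ∑ i ∈ s, (∏ k ∈ s.erase j, (v i - w k)) / ∏ k ∈ s.erase i, (v i - v k) = 1 := by
  have hcard : (#s : WithBot ℕ) = (Lagrange.nodal (s.erase j) w).degree + 1 := by
    rw [Lagrange.degree_nodal, ← card_erase_add_one hj]
    norm_cast
  have h := Lagrange.leadingCoeff_eq_sum hv hcard
  rw [Lagrange.nodal_monic.leadingCoeff] at h
  simpa only [Lagrange.eval_nodal] using h.symm

/-- Partial-fraction (Lagrange interpolation) identity for the Bethe-root weights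
`ρ_α = Π_{β≠α} (q_α − q_β + c)/(q_α − q_β)`: for every `γ`,
`Σ_α ρ_α/(q_α − q_γ + c) = 1/c`. -/
theorem sum_rho_div_eq_one_div_c (m : ℕ) (hm : 1 ≤ m) (q : Fin m → ℂ)
    (hq : Function.Injective q) (c : ℂ) (hc : c ≠ 0)
    (hqc : ∀ α γ : Fin m, q α - q γ + c ≠ 0) :
    ∀ γ : Fin m,
      ∑ α : Fin m,
        (∏ β ∈ Finset.univ.erase α, (q α - q β + c) / (q α - q β)) / (q α - q γ + c)
      = 1 / c := by
  intro γ
  rw [← sum_prod_erase_sub_div_prod_erase_sub hq.injOn (fun β => q β - c) (mem_univ γ), sum_div]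
  refine sum_congr rfl fun α _ => ?_
  have hα := mul_prod_erase univ (fun β => q α - q β + c) (mem_univ α)
  have hγ := mul_prod_erase univ (fun β => q α - q β + c) (mem_univ γ)
  simp only [sub_self, zero_add] at hα
  have key := hα.trans hγ.symm
  simp only [← sub_add]
  rw [prod_div_distrib, div_right_comm, div_right_comm (∏ k ∈ univ.erase γ, _)]
  congr 1
  rw [div_eq_div_iff (hqc α γ) hc]
  linear_combination key
end

section
/- Let n ≥ 1, c ∈ ℂ, and q₁, …, qₙ ∈ ℂ; set q_{−i} = −q_i and let I_n = {1,…,n,−1,…,−n}. Assume the 2n numbers (q_α)_{α∈I_n} are pairwise distinct (i.e. all q_i ≠ 0 and q_i ≠ ±q_j for i ≠ j), and define ρ_α = Π_{β∈I_n, β≠α} (q_α − q_β + c)/(q_α − q_β). Then: (i) Σ_{α∈I_n} ρ_α = 2n; (ii) Σ_{α∈I_n} q_α ρ_α = c·n(2n−1); (iii) Σ_{α∈I_n} q_α² ρ_α = (2/3)c²·n(n−1)(2n−1) + 2Σ_{i=1}^{n} q_i². -/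
open Finset

/-- The symmetric family of Bethe roots `(q_α)_{α ∈ I_n} = (q₁,…,qₙ,−q₁,…,−qₙ)`,
indexed by `Fin n ⊕ Fin n` (`inl i ↔ q_i`, `inr i ↔ q_{−i} = −q_i`). -/
noncomputable def qFull {n : ℕ} (Q : Fin n → ℂ) : Fin n ⊕ Fin n → ℂ :=
  Sum.elim Q (fun i => -Q i)

/-- The weight `ρ_α = Π_{β≠α} (q_α − q_β + c)/(q_α − q_β)`. -/
noncomputable def rhoFull {n : ℕ} (Q : Fin n → ℂ) (c : ℂ) (α : Fin n ⊕ Fin n) : ℂ :=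
  ∏ β ∈ Finset.univ.erase α, (qFull Q α - qFull Q β + c) / (qFull Q α - qFull Q β)

/-- The weight of the node `a` in the finite family of nodes `v`, indexed by `s`, with shift `c`. -/
def shiftWeight {ι K : Type*} [DecidableEq ι] [Field K] (v : ι → K) (c : K) (s : Finset ι)
    (a : ι) : K :=
  ∏ b ∈ s.erase a, (v a - v b + c) / (v a - v b)

section ShiftWeight

variable {ι K : Type*} [DecidableEq ι] [Field K] {v : ι → K} {s : Finset ι} {x : ι}

theorem shiftWeight_insert_self (c : K) (hx : x ∉ s) :
    shiftWeight v c (insert x s) x = ∏ b ∈ s, (v x - v b + c) / (v x - v b) := by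
  rw [shiftWeight, Finset.erase_insert hx]

theorem shiftWeight_insert_of_mem (hv : Function.Injective v) (c : K) (hx : x ∉ s) {a : ι}
    (ha : a ∈ s) :
    shiftWeight v c (insert x s) a = shiftWeight v c s a * (1 + c / (v a - v x)) := by
  have hax : a ≠ x := fun h => hx (h ▸ ha)
  have hne : v a - v x ≠ 0 := sub_ne_zero.mpr (hv.ne hax)
  rw [shiftWeight, Finset.erase_insert_of_ne hax.symm,
    Finset.prod_insert fun h => hx (Finset.mem_of_mem_erase h), mul_comm, shiftWeight]
  congr 1
  field_simp

/-- Partial fraction expansion of the product of the shifted ratios. -/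
theorem prod_shift_div_eq (hv : Function.Injective v) (c : K) (s : Finset ι) (u : K)
    (hu : ∀ b ∈ s, u ≠ v b) :
    ∏ b ∈ s, (u - v b + c) / (u - v b) = 1 + c * ∑ a ∈ s, shiftWeight v c s a / (u - v a) := by
  induction s using Finset.induction_on generalizing u with
  | empty => simp
  | insert x s hx ih =>
    have hux : u - v x ≠ 0 := sub_ne_zero.mpr (hu x (Finset.mem_insert_self x s))
    have hxs : ∀ b ∈ s, v x ≠ v b := fun b hb h => hx (hv h ▸ hb)
    have hsum : ∑ a ∈ s, shiftWeight v c (insert x s) a / (u - v a)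
        = (1 + c / (u - v x)) * ∑ a ∈ s, shiftWeight v c s a / (u - v a)
          - c / (u - v x) * ∑ a ∈ s, shiftWeight v c s a / (v x - v a) := by
      rw [Finset.mul_sum, Finset.mul_sum, ← Finset.sum_sub_distrib]
      refine Finset.sum_congr rfl fun a ha => ?_
      have h1 : u - v a ≠ 0 := sub_ne_zero.mpr (hu a (Finset.mem_insert_of_mem ha))
      have h2 : v x - v a ≠ 0 := sub_ne_zero.mpr (hxs a ha)
      rw [shiftWeight_insert_of_mem hv c hx ha, ← neg_sub (v x) (v a)]
      field_simp
      ring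
    rw [Finset.prod_insert hx, Finset.sum_insert hx, shiftWeight_insert_self c hx, ih _ hxs,
      ih u fun b hb => hu b (Finset.mem_insert_of_mem hb), hsum]
    field_simp
    ring

/-- Recursion for the power moments of the weights when a node is added. -/
theorem sum_pow_mul_shiftWeight_insert (hv : Function.Injective v) (c : K) (hx : x ∉ s) (k : ℕ) :
    ∑ a ∈ insert x s, v a ^ k * shiftWeight v c (insert x s) a
      = ∑ a ∈ s, v a ^ k * shiftWeight v c s a + v x ^ k
        + c * ∑ j ∈ Finset.range k, v x ^ (k - 1 - j) * ∑ a ∈ s, v a ^ j * shiftWeight v c s a := by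
  have hxs : ∀ b ∈ s, v x ≠ v b := fun b hb h => hx (hv h ▸ hb)
  have hsum : ∑ j ∈ Finset.range k, v x ^ (k - 1 - j) * ∑ a ∈ s, v a ^ j * shiftWeight v c s a
      = ∑ a ∈ s, (v a ^ k - v x ^ k) / (v a - v x) * shiftWeight v c s a := by
    simp_rw [Finset.mul_sum]
    rw [Finset.sum_comm]
    refine Finset.sum_congr rfl fun a ha => ?_
    rw [← geom₂_sum (hxs a ha).symm, Finset.sum_mul]
    exact Finset.sum_congr rfl fun j _ => by ring
  rw [Finset.sum_insert hx, shiftWeight_insert_self c hx, prod_shift_div_eq hv c s _ hxs, hsum,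
    mul_add, mul_one, mul_left_comm, Finset.mul_sum (a := v x ^ k), add_right_comm _ (v x ^ k),
    add_comm (v x ^ k), add_right_comm, add_left_inj, Finset.mul_sum, Finset.mul_sum,
    ← Finset.sum_add_distrib, ← Finset.sum_add_distrib]
  refine Finset.sum_congr rfl fun a ha => ?_
  have h2 : v x - v a ≠ 0 := sub_ne_zero.mpr (hxs a ha)
  rw [shiftWeight_insert_of_mem hv c hx ha, ← neg_sub (v x) (v a)]
  field_simp
  ring

theorem sum_shiftWeight (hv : Function.Injective v) (c : K) (s : Finset ι) :
    ∑ a ∈ s, shiftWeight v c s a = s.card := by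
  induction s using Finset.induction_on with
  | empty => simp
  | insert x s hx ih =>
    have h := sum_pow_mul_shiftWeight_insert hv c hx 0
    simp only [pow_zero, one_mul, Finset.range_zero, Finset.sum_empty, mul_zero, add_zero] at h
    rw [h, ih, Finset.card_insert_of_notMem hx, Nat.cast_succ]

theorem sum_mul_shiftWeight [CharZero K] (hv : Function.Injective v) (c : K) (s : Finset ι) :
    ∑ a ∈ s, v a * shiftWeight v c s a = ∑ a ∈ s, v a + c * (s.card * (s.card - 1) / 2) := by
  induction s using Finset.induction_on with
  | empty => simp
  | insert x s hx ih =>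
    have h := sum_pow_mul_shiftWeight_insert hv c hx 1
    simp only [pow_one, Finset.sum_range_one, Nat.sub_self, pow_zero, one_mul,
      sum_shiftWeight hv] at h
    rw [h, ih, Finset.card_insert_of_notMem hx, Nat.cast_succ, Finset.sum_insert hx]
    field_simp
    ring

theorem sum_sq_mul_shiftWeight [CharZero K] (hv : Function.Injective v) (c : K) (s : Finset ι) :
    ∑ a ∈ s, v a ^ 2 * shiftWeight v c s a
      = ∑ a ∈ s, v a ^ 2 + c * (s.card - 1) * ∑ a ∈ s, v a
        + c ^ 2 * (s.card * (s.card - 1) * (s.card - 2) / 6) := by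
  induction s using Finset.induction_on with
  | empty => simp
  | insert x s hx ih =>
    have h := sum_pow_mul_shiftWeight_insert hv c hx 2
    simp only [Finset.sum_range_succ, Finset.sum_range_zero, zero_add, Nat.add_one_sub_one,
      Nat.sub_self, Nat.sub_zero, pow_zero, pow_one, one_mul, sum_shiftWeight hv,
      sum_mul_shiftWeight hv] at h
    rw [h, ih, Finset.card_insert_of_notMem hx, Nat.cast_succ, Finset.sum_insert hx,
      Finset.sum_insert hx]
    field_simp
    ring

end ShiftWeight

theorem qFull_injective {n : ℕ} {Q : Fin n → ℂ} (hQ0 : ∀ i, Q i ≠ 0)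
    (hQd : ∀ i j, i ≠ j → Q i ≠ Q j ∧ Q i ≠ -Q j) : Function.Injective (qFull Q) := by
  have hinj : Function.Injective Q := fun i j h => by
    by_contra hij
    exact (hQd i j hij).1 h
  refine hinj.sumElim (neg_injective.comp hinj) fun i j h => ?_
  obtain rfl | hij := eq_or_ne i j
  · exact hQ0 i (self_eq_neg.mp h)
  · exact (hQd i j hij).2 h

/-- Moment identities for the symmetric Bethe-root weights:
`Σ ρ_α = 2n`, `Σ q_α ρ_α = c·n(2n−1)`,
`Σ q_α² ρ_α = (2/3)c²·n(n−1)(2n−1) + 2Σ q_i²`. -/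
theorem rho_moment_identities (n : ℕ) (hn : 1 ≤ n) (c : ℂ) (Q : Fin n → ℂ)
    (hQ0 : ∀ i, Q i ≠ 0)
    (hQd : ∀ i j, i ≠ j → Q i ≠ Q j ∧ Q i ≠ -Q j) :
    (∑ α : Fin n ⊕ Fin n, rhoFull Q c α) = 2 * n ∧
    (∑ α : Fin n ⊕ Fin n, qFull Q α * rhoFull Q c α) = c * n * (2 * n - 1) ∧
    (∑ α : Fin n ⊕ Fin n, (qFull Q α) ^ 2 * rhoFull Q c α)
      = (2 / 3) * c ^ 2 * n * (n - 1) * (2 * n - 1) + 2 * ∑ i : Fin n, Q i ^ 2 := by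
  have hv := qFull_injective hQ0 hQd
  have hρ : ∀ α, rhoFull Q c α = shiftWeight (qFull Q) c Finset.univ α := fun _ => rfl
  have hcard : ((Finset.univ : Finset (Fin n ⊕ Fin n)).card : ℂ) = 2 * n := by
    simp [two_mul]
  have hp1 : ∑ α, qFull Q α = 0 := by simp [qFull]
  have hp2 : ∑ α, qFull Q α ^ 2 = 2 * ∑ i, Q i ^ 2 := by simp [qFull, two_mul]
  simp only [hρ]
  rw [sum_shiftWeight hv, sum_mul_shiftWeight hv, sum_sq_mul_shiftWeight hv, hcard, hp1, hp2]
  refine ⟨rfl, ?_, ?_⟩ <;> ring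
end

section
/- For every a > 0, ∫_ℝ (dy/2π) e^{−y²}/(y²+a) = e^a·erfc(√a)/(2√a), where erfc(x) = (2/√π)∫_x^∞ e^{−s²} ds is the complementary error function. -/
open Real MeasureTheory

/-- The complementary error function `erfc x = (2/√π)∫_x^∞ e^{−s²} ds`. -/
noncomputable def erfc (x : ℝ) : ℝ :=
  (2 / Real.sqrt Real.pi) * ∫ s in Set.Ioi x, Real.exp (-s ^ 2)

theorem integral_Ioi_one_two_mul_mul_exp_neg_mul_sq {c : ℝ} (hc : 0 < c) :
    ∫ r in Set.Ioi (1 : ℝ), 2 * r * exp (-c * r ^ 2) = exp (-c) / c := by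
  have hderiv (r : ℝ) :
      HasDerivAt (fun r : ℝ => -exp (-c * r ^ 2) / c) (2 * r * exp (-c * r ^ 2)) r := by
    have h := (((hasDerivAt_pow 2 r).const_mul (-c)).exp.neg).div_const c
    convert! h using 1
    field_simp
    push_cast
    ring
  have hint : IntegrableOn (fun r : ℝ => 2 * r * exp (-c * r ^ 2)) (Set.Ioi 1) := by
    have h := (integrable_mul_exp_neg_mul_sq hc).const_mul 2
    simpa only [mul_assoc] using h.integrableOn
  have hlim : Filter.Tendsto (fun r : ℝ => -exp (-c * r ^ 2) / c) Filter.atTop (nhds 0) := by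
    have h : Filter.Tendsto (fun r : ℝ => -c * r ^ 2) Filter.atTop Filter.atBot :=
      (Filter.tendsto_pow_atTop two_ne_zero).const_mul_atTop_of_neg (neg_neg_of_pos hc)
    simpa using ((tendsto_exp_atBot.comp h).neg).div_const c
  rw [integral_Ioi_of_hasDerivAt_of_tendsto' (fun r _ => hderiv r) hint hlim]
  simp [neg_div]

theorem integral_two_mul_mul_exp_neg_add_mul_sq (a : ℝ) {r : ℝ} (hr : 0 < r) :
    ∫ y : ℝ, 2 * r * exp (-(y ^ 2 + a) * r ^ 2) = 2 * √π * exp (-a * r ^ 2) := by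
  have h (y : ℝ) : 2 * r * exp (-(y ^ 2 + a) * r ^ 2)
      = 2 * r * exp (-a * r ^ 2) * exp (-r ^ 2 * y ^ 2) := by
    rw [mul_assoc _ (exp _), ← exp_add]
    ring_nf
  simp_rw [h]
  rw [integral_const_mul, integral_gaussian, sqrt_div pi_pos.le, sqrt_sq hr.le]
  field_simp

theorem integrable_two_mul_mul_exp_neg_add_mul_sq {a : ℝ} (ha : 0 < a) :
    Integrable (Function.uncurry fun y r : ℝ => 2 * r * exp (-(y ^ 2 + a) * r ^ 2))
      (volume.prod (volume.restrict (Set.Ioi 1))) := by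
  have hcont : Continuous
      (Function.uncurry fun y r : ℝ => 2 * r * exp (-(y ^ 2 + a) * r ^ 2)) := by
    unfold Function.uncurry
    fun_prop
  rw [integrable_prod_iff' hcont.aestronglyMeasurable]
  refine ⟨?_, ?_⟩
  · filter_upwards [ae_restrict_mem measurableSet_Ioi] with r hr
    have hr0 : (0 : ℝ) < r := one_pos.trans hr
    refine ((integrable_exp_neg_mul_sq (pow_pos hr0 2)).const_mul
      (2 * r * exp (-a * r ^ 2))).congr (.of_forall fun y => ?_)
    simp only [Function.uncurry_apply_pair]
    rw [mul_assoc _ (exp _), ← exp_add]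
    ring_nf
  · refine ((integrable_exp_neg_mul_sq ha).const_mul (2 * √π)).integrableOn.congr ?_
    filter_upwards [ae_restrict_mem measurableSet_Ioi] with r hr
    have hr0 : (0 : ℝ) < r := one_pos.trans hr
    rw [← integral_two_mul_mul_exp_neg_add_mul_sq a hr0]
    refine integral_congr_ae (.of_forall fun y => ?_)
    simp only [Function.uncurry_apply_pair]
    rw [norm_of_nonneg (by positivity)]

theorem integral_Ioi_one_exp_neg_mul_sq {a : ℝ} (ha : 0 < a) :
    ∫ r in Set.Ioi (1 : ℝ), exp (-a * r ^ 2) = (√a)⁻¹ * ∫ s in Set.Ioi √a, exp (-s ^ 2) := by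
  have h := integral_comp_mul_left_Ioi (fun s : ℝ => exp (-s ^ 2)) 1 (sqrt_pos.2 ha)
  simpa only [mul_pow, sq_sqrt ha.le, mul_one, smul_eq_mul, neg_mul] using h

/-- For every `a > 0`, `∫_ℝ (dy/2π) e^{−y²}/(y²+a) = e^a · erfc(√a)/(2√a)`. -/
theorem integral_gaussian_div_quadratic (a : ℝ) (ha : 0 < a) :
    ∫ y : ℝ, Real.exp (-y ^ 2) / (y ^ 2 + a) / (2 * Real.pi)
      = Real.exp a * erfc (Real.sqrt a) / (2 * Real.sqrt a) := by
  have hrepr (y : ℝ) : exp (-y ^ 2) / (y ^ 2 + a)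
      = exp a * ∫ r in Set.Ioi (1 : ℝ), 2 * r * exp (-(y ^ 2 + a) * r ^ 2) := by
    rw [integral_Ioi_one_two_mul_mul_exp_neg_mul_sq (by positivity), ← mul_div_assoc, ← exp_add]
    ring_nf
  have hswap : ∫ y : ℝ, ∫ r in Set.Ioi (1 : ℝ), 2 * r * exp (-(y ^ 2 + a) * r ^ 2)
      = 2 * √π * ((√a)⁻¹ * ∫ s in Set.Ioi √a, exp (-s ^ 2)) := by
    rw [integral_integral_swap (integrable_two_mul_mul_exp_neg_add_mul_sq ha),
      ← integral_Ioi_one_exp_neg_mul_sq ha, ← integral_const_mul]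
    exact setIntegral_congr_fun measurableSet_Ioi fun r hr =>
      integral_two_mul_mul_exp_neg_add_mul_sq a (one_pos.trans hr)
  rw [integral_div]
  simp_rw [hrepr]
  rw [integral_const_mul, hswap, erfc]
  have hpi : √π ^ 2 = π := sq_sqrt pi_pos.le
  have := sqrt_pos.2 ha
  have := sqrt_pos.2 pi_pos
  field_simp
  rw [hpi, mul_comm]
end

section
/- For every u > 0, ∫_ℝ (dy/2π) 4y²e^{−y²}/(u²+y²)² = e^{u²}(2u²+1)·erfc(u)/u − 2/√π, where erfc(x) = (2/√π)∫_x^∞ e^{−s²} ds is the complementary error function. -/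
open Real MeasureTheory

open Set Filter Topology

lemma integrable_exp_neg_sq : Integrable fun s : ℝ => Real.exp (-s ^ 2) := by
  simpa using integrable_exp_neg_mul_sq (b := 1) one_pos

lemma integrable_sq_mul_exp_neg_sq : Integrable fun y : ℝ => y ^ 2 * Real.exp (-y ^ 2) := by
  have h := integrable_rpow_mul_exp_neg_mul_sq (b := 1) one_pos (s := 2) (by norm_num)
  simpa using h

lemma integral_sq_mul_exp_neg_mul_sq {b : ℝ} (hb : 0 < b) :
    ∫ y : ℝ, y ^ 2 * Real.exp (-b * y ^ 2) = Real.sqrt Real.pi / 2 / (b * Real.sqrt b) := by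
  have h1 := integral_comp_abs (f := fun y : ℝ => y ^ 2 * Real.exp (-b * y ^ 2))
  simp only [sq_abs] at h1
  have h2 := integral_rpow_mul_exp_neg_mul_rpow (p := 2) (q := 2) (b := b)
    two_pos (by norm_num) hb
  simp only [Real.rpow_two] at h2
  have h3 : Real.Gamma ((2 + 1) / 2) = Real.sqrt Real.pi / 2 := by
    rw [show ((2 : ℝ) + 1) / 2 = 1 / 2 + 1 by norm_num, Real.Gamma_add_one (by norm_num),
      Real.Gamma_one_half_eq]
    ring
  have h4 : b ^ (-((2 : ℝ) + 1) / 2) = (b * Real.sqrt b)⁻¹ := by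
    rw [show -((2 : ℝ) + 1) / 2 = -(1 + 1 / 2) by norm_num, Real.rpow_neg hb.le,
      Real.rpow_add hb, Real.rpow_one, ← Real.sqrt_eq_rpow]
  rw [h1, h2, h3, h4]
  field_simp

lemma integral_Ioi_mul_exp_neg_mul {r : ℝ} (hr : 0 < r) :
    ∫ t in Ioi (0 : ℝ), t * Real.exp (-(r * t)) = 1 / r ^ 2 := by
  have h := Real.integral_rpow_mul_exp_neg_mul_Ioi (a := 2) two_pos hr
  norm_num [Real.Gamma_two] at h
  simpa using h

lemma integrableOn_Ioi_mul_exp_neg_mul {r : ℝ} (hr : 0 < r) :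
    IntegrableOn (fun t : ℝ => t * Real.exp (-(r * t))) (Ioi 0) := by
  have h := integrableOn_rpow_mul_exp_neg_mul_rpow (p := 1) (s := 1) (b := r)
    (by norm_num) one_pos hr
  simpa using h

lemma integral_sq_mul_exp_neg_sq_div_eq {u : ℝ} (hu : 0 < u) :
    ∫ y : ℝ, y ^ 2 * Real.exp (-y ^ 2) / (u ^ 2 + y ^ 2) ^ 2
      = Real.sqrt Real.pi / 2 * ∫ t in Ioi (0 : ℝ),
        t * Real.exp (-(u ^ 2 * t)) / ((1 + t) * Real.sqrt (1 + t)) := by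
  have h_int : Integrable (Function.uncurry fun y t : ℝ =>
      (y ^ 2 * Real.exp (-y ^ 2)) * (t * Real.exp (-((u ^ 2 + y ^ 2) * t))))
      (volume.prod (volume.restrict (Ioi 0))) := by
    refine (integrable_sq_mul_exp_neg_sq.mul_prod
      (integrableOn_Ioi_mul_exp_neg_mul (r := u ^ 2) (by positivity))).mono'
      (by fun_prop) ?_
    have hpos : ∀ᵐ z : ℝ × ℝ ∂(volume.prod (volume.restrict (Ioi 0))), 0 < z.2 :=
      Measure.quasiMeasurePreserving_snd.ae (ae_restrict_mem measurableSet_Ioi)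
    filter_upwards [hpos] with z hz
    rw [Function.uncurry, Real.norm_of_nonneg (by positivity)]
    gcongr
    nlinarith [mul_nonneg (sq_nonneg z.1) hz.le]
  calc
    _ = ∫ y : ℝ, ∫ t in Ioi (0 : ℝ),
        (y ^ 2 * Real.exp (-y ^ 2)) * (t * Real.exp (-((u ^ 2 + y ^ 2) * t))) := by
      congr 1 with y
      rw [integral_const_mul, integral_Ioi_mul_exp_neg_mul (by positivity)]
      ring
    _ = ∫ t in Ioi (0 : ℝ), ∫ y : ℝ,
        (y ^ 2 * Real.exp (-y ^ 2)) * (t * Real.exp (-((u ^ 2 + y ^ 2) * t))) :=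
      integral_integral_swap h_int
    _ = _ := by
      rw [← integral_const_mul]
      refine setIntegral_congr_fun measurableSet_Ioi fun t (ht : 0 < t) => ?_
      have h : ∀ y : ℝ, (y ^ 2 * Real.exp (-y ^ 2)) * (t * Real.exp (-((u ^ 2 + y ^ 2) * t)))
          = t * Real.exp (-(u ^ 2 * t)) * (y ^ 2 * Real.exp (-(1 + t) * y ^ 2)) := by
        intro y
        rw [show -(1 + t) * y ^ 2 = -y ^ 2 + -(y ^ 2 * t) by ring,
          show -((u ^ 2 + y ^ 2) * t) = -(u ^ 2 * t) + -(y ^ 2 * t) by ring,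
          Real.exp_add, Real.exp_add]
        ring
      simp only [h]
      rw [integral_const_mul, integral_sq_mul_exp_neg_mul_sq (by positivity)]
      ring

lemma hasDerivAt_integral_exp_neg_sq (x : ℝ) :
    HasDerivAt (fun x : ℝ => ∫ s in (0 : ℝ)..x, Real.exp (-s ^ 2)) (Real.exp (-x ^ 2)) x :=
  intervalIntegral.integral_hasDerivAt_right
    ((by fun_prop : Continuous fun s : ℝ => Real.exp (-s ^ 2)).intervalIntegrable _ _)
    ((by fun_prop : Continuous fun s : ℝ => Real.exp (-s ^ 2)).stronglyMeasurableAtFilter _ _)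
    (by fun_prop)

lemma integral_Ioi_mul_exp_neg_div {u : ℝ} (hu : 0 < u) :
    ∫ t in Ioi (0 : ℝ), t * Real.exp (-(u ^ 2 * t)) / ((1 + t) * Real.sqrt (1 + t))
      = 2 * (1 + 2 * u ^ 2) * Real.exp (u ^ 2) / u * (∫ s in Ioi u, Real.exp (-s ^ 2)) - 2 := by
  have hsqrt : Tendsto (fun t : ℝ => Real.sqrt (1 + t)) atTop atTop :=
    Real.tendsto_sqrt_atTop.comp (tendsto_atTop_add_const_left _ _ tendsto_id)
  have hlim : Tendsto (fun t : ℝ =>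
      2 * (1 + 2 * u ^ 2) * Real.exp (u ^ 2) / u
          * (∫ s in (0 : ℝ)..(u * Real.sqrt (1 + t)), Real.exp (-s ^ 2))
        + 2 * (Real.exp (-(u ^ 2 * t)) * (Real.sqrt (1 + t))⁻¹)) atTop
      (𝓝 (2 * (1 + 2 * u ^ 2) * Real.exp (u ^ 2) / u
          * (∫ s in Ioi (0 : ℝ), Real.exp (-s ^ 2)) + 2 * (0 * 0))) := by
    refine Tendsto.add (Tendsto.const_mul _ ?_) (Tendsto.const_mul _ (Tendsto.mul ?_ ?_))
    · exact intervalIntegral_tendsto_integral_Ioi 0 integrable_exp_neg_sq.integrableOn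
        (hsqrt.const_mul_atTop hu)
    · exact Real.tendsto_exp_neg_atTop_nhds_zero.comp
        (tendsto_id.const_mul_atTop (by positivity : 0 < u ^ 2))
    · exact tendsto_inv_atTop_zero.comp hsqrt
  rw [integral_Ioi_of_hasDerivAt_of_nonneg' ?_ ?_ hlim]
  · have h := intervalIntegral.integral_interval_add_Ioi (a := 0) (b := u)
      integrable_exp_neg_sq.integrableOn integrable_exp_neg_sq.integrableOn
    rw [← h]
    simp
    ring
  · intro t (ht : 0 ≤ t)
    have hw : 0 < Real.sqrt (1 + t) := by positivity
    have hw2 : Real.sqrt (1 + t) ^ 2 = 1 + t := Real.sq_sqrt (by positivity)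
    have hs : HasDerivAt (fun t : ℝ => Real.sqrt (1 + t)) (1 / (2 * Real.sqrt (1 + t))) t :=
      ((hasDerivAt_id t).const_add 1).sqrt (by positivity)
    have hE := (hasDerivAt_integral_exp_neg_sq (u * Real.sqrt (1 + t))).comp t (hs.const_mul u)
    have he : HasDerivAt (fun t : ℝ => Real.exp (-(u ^ 2 * t)))
        (Real.exp (-(u ^ 2 * t)) * -(u ^ 2 * 1)) t :=
      ((hasDerivAt_id t).const_mul (u ^ 2)).neg.exp
    refine ((hE.const_mul (2 * (1 + 2 * u ^ 2) * Real.exp (u ^ 2) / u)).add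
      ((he.mul (hs.inv hw.ne')).const_mul 2)).congr_deriv ?_
    have hexp : Real.exp (-(u * Real.sqrt (1 + t)) ^ 2)
        = Real.exp (-(u ^ 2 * t)) / Real.exp (u ^ 2) := by
      rw [← Real.exp_sub, mul_pow, hw2]
      ring_nf
    rw [hexp, Pi.inv_apply, ← hw2]
    have ht' : t = Real.sqrt (1 + t) ^ 2 - 1 := by rw [hw2]; ring
    generalize Real.exp (-(u ^ 2 * t)) = e
    generalize Real.sqrt (1 + t) = w at *
    subst ht'
    rw [Real.sqrt_sq hw.le]
    field_simp
    ring
  · intro t (ht : 0 < t)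
    positivity

/-- For every `u > 0`,
`∫_ℝ (dy/2π) 4y²e^{−y²}/(u²+y²)² = e^{u²}(2u²+1)·erfc(u)/u − 2/√π`. -/
theorem integral_phi_one_equal_parameters (u : ℝ) (hu : 0 < u) :
    ∫ y : ℝ, 4 * y ^ 2 * Real.exp (-y ^ 2) / (u ^ 2 + y ^ 2) ^ 2 / (2 * Real.pi)
      = Real.exp (u ^ 2) * (2 * u ^ 2 + 1) * erfc u / u - 2 / Real.sqrt Real.pi := by
  have h : ∀ y : ℝ, 4 * y ^ 2 * Real.exp (-y ^ 2) / (u ^ 2 + y ^ 2) ^ 2 / (2 * Real.pi)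
      = 2 / Real.pi * (y ^ 2 * Real.exp (-y ^ 2) / (u ^ 2 + y ^ 2) ^ 2) := by
    intro y
    field_simp
    ring
  simp only [h]
  rw [integral_const_mul, integral_sq_mul_exp_neg_sq_div_eq hu, integral_Ioi_mul_exp_neg_div hu,
    erfc]
  have hpi : Real.sqrt Real.pi ^ 2 = Real.pi := Real.sq_sqrt Real.pi_pos.le
  have hsp : 0 < Real.sqrt Real.pi := Real.sqrt_pos.2 Real.pi_pos
  generalize (∫ s in Ioi u, Real.exp (-s ^ 2)) = E
  nth_rewrite 1 [← hpi]
  field_simp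
  ring
end
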